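/- In U_q[gl(m|n)], for indices with c < a < b, the graded commutator satisfies [E^a_c, E^c_b] = E^a_b K_a K_c^{-1}. -/

import Mathlib

/-!
U_q[gl(m|n)]: the quantum superalgebra presented by generators and relations,
following Zhang (1993).  We work over the field ℚ(q) of rational functions.
-/

noncomputable section

/-- The base field ℚ(q) of rational functions in the indeterminate q. -/
abbrev Fq : Type := RatFunc ℚ

/-- The indeterminate q. -/
def qq : Fq := RatFunc.X

/-- The ℤ₂-grading of an index: `[a] = 0` if `a ≤ m`, `[a] = 1` if `a > m`. -/
def gr (m a : ℕ) : ℕ := if a ≤ m then 0 else 1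

/-- `q_a = q^{(-1)^{[a]}}`. -/
def qi (m a : ℕ) : Fq := if a ≤ m then qq else qq⁻¹

/-- `Δ = q - q⁻¹`. -/
def Δq : Fq := qq - qq⁻¹

/-- `Δ_a = (-1)^{[a]} Δ`. -/
def Δi (m a : ℕ) : Fq := (-1 : Fq) ^ gr m a * Δq

/-- Kronecker delta, as an integer. -/
def δℤ (a b : ℕ) : ℤ := if a = b then 1 else 0

/-- The sign `(-1)^{[E^a_b][E^c_d]}`, where `[E^a_b] = [a] + [b] (mod 2)`. -/
def sgn (m a b c d : ℕ) : Fq := (-1 : Fq) ^ ((gr m a + gr m b) * (gr m c + gr m d))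

/-- The quantum superalgebra `U_q[gl(m|n)]`: a unital associative ℚ(q)-algebra with
invertible Cartan generators `K a` (`1 ≤ a ≤ m+n`) and generators `E a b`
(simple ones for `|a-b| = 1`, nonsimple ones defined recursively for `|a-b| > 1`),
subject to the defining relations below. -/
structure UqGl (m n : ℕ) where
  /-- the underlying carrier -/
  A : Type
  ringA : Ring A
  algA : Algebra Fq A
  /-- Cartan generators `K_a` -/
  K : ℕ → A
  /-- inverse Cartan generators `K_a⁻¹` -/
  Kinv : ℕ → A
  /-- generators `E^a_b` -/
  E : ℕ → ℕ → A
  /-- (i) the Cartan generators commute -/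
  K_comm : ∀ a b, 1 ≤ a → a ≤ m + n → 1 ≤ b → b ≤ m + n →
    K a * K b = K b * K a
  /-- (i) `K_a K_a⁻¹ = 1` -/
  K_Kinv : ∀ a, 1 ≤ a → a ≤ m + n → K a * Kinv a = 1
  /-- (i) `K_a⁻¹ K_a = 1` -/
  Kinv_K : ∀ a, 1 ≤ a → a ≤ m + n → Kinv a * K a = 1
  /-- (ii) `K_a E^b_{b+1} = q_a^{δ^a_b - δ^a_{b+1}} E^b_{b+1} K_a` -/
  K_E_raise : ∀ a b, 1 ≤ a → a ≤ m + n → 1 ≤ b → b + 1 ≤ m + n →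
    K a * E b (b+1) = (qi m a ^ (δℤ a b - δℤ a (b+1))) • (E b (b+1) * K a)
  /-- (ii) `K_a E^{b+1}_b = q_a^{δ^a_{b+1} - δ^a_b} E^{b+1}_b K_a` -/
  K_E_lower : ∀ a b, 1 ≤ a → a ≤ m + n → 1 ≤ b → b + 1 ≤ m + n →
    K a * E (b+1) b = (qi m a ^ (δℤ a (b+1) - δℤ a b)) • (E (b+1) b * K a)
  /-- (iii) `[E^a_{a+1}, E^{b+1}_b] = δ^a_b Δ_a⁻¹ (K_a K_{a+1}⁻¹ - K_a⁻¹ K_{a+1})` -/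
  EF_rel : ∀ a b, 1 ≤ a → a + 1 ≤ m + n → 1 ≤ b → b + 1 ≤ m + n →
    E a (a+1) * E (b+1) b - sgn m a (a+1) (b+1) b • (E (b+1) b * E a (a+1)) =
      (if a = b then (Δi m a)⁻¹ else 0) • (K a * Kinv (a+1) - Kinv a * K (a+1))
  /-- (iv) simple lowering generators commute when `|a-b| > 1` -/
  EE_lower : ∀ a b, 1 ≤ a → a + 1 ≤ m + n → 1 ≤ b → b + 1 ≤ m + n →
    (a + 1 < b ∨ b + 1 < a) →
    E (a+1) a * E (b+1) b = E (b+1) b * E (a+1) a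
  /-- (iv) simple raising generators commute when `|a-b| > 1` -/
  EE_raise : ∀ a b, 1 ≤ a → a + 1 ≤ m + n → 1 ≤ b → b + 1 ≤ m + n →
    (a + 1 < b ∨ b + 1 < a) →
    E a (a+1) * E b (b+1) = E b (b+1) * E a (a+1)
  /-- (v) the square of the odd simple raising generator is zero -/
  odd_raise_sq : E m (m+1) * E m (m+1) = 0
  /-- (v) the square of the odd simple lowering generator is zero -/
  odd_lower_sq : E (m+1) m * E (m+1) m = 0
  /-- (vi) Serre relation `E^{a+1}_a E^{a+2}_a = q_a E^{a+2}_a E^{a+1}_a`, `a ≠ m` -/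
  serre1 : m ≠ 1 → n ≠ 1 → ∀ a, 1 ≤ a → a + 2 ≤ m + n → a ≠ m →
    E (a+1) a * E (a+2) a = qi m a • (E (a+2) a * E (a+1) a)
  /-- (vi) Serre relation `E^a_{a+1} E^a_{a+2} = q_a E^a_{a+2} E^a_{a+1}`, `a ≠ m` -/
  serre2 : m ≠ 1 → n ≠ 1 → ∀ a, 1 ≤ a → a + 2 ≤ m + n → a ≠ m →
    E a (a+1) * E a (a+2) = qi m a • (E a (a+2) * E a (a+1))
  /-- (vi) Serre relation `E^{a+1}_{a-1} E^{a+1}_a = q_a E^{a+1}_a E^{a+1}_{a-1}`, `a ≠ m` -/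
  serre3 : m ≠ 1 → n ≠ 1 → ∀ a, 2 ≤ a → a + 1 ≤ m + n → a ≠ m →
    E (a+1) (a-1) * E (a+1) a = qi m a • (E (a+1) a * E (a+1) (a-1))
  /-- (vi) Serre relation `E^{a-1}_{a+1} E^a_{a+1} = q_a E^a_{a+1} E^{a-1}_{a+1}`, `a ≠ m` -/
  serre4 : m ≠ 1 → n ≠ 1 → ∀ a, 2 ≤ a → a + 1 ≤ m + n → a ≠ m →
    E (a-1) (a+1) * E a (a+1) = qi m a • (E a (a+1) * E (a-1) (a+1))
  /-- (vi) Serre relation `[E^{m+1}_m, E^{m+2}_{m-1}] = 0` -/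
  serre5 : m ≠ 1 → n ≠ 1 →
    E (m+1) m * E (m+2) (m-1) -
      sgn m (m+1) m (m+2) (m-1) • (E (m+2) (m-1) * E (m+1) m) = 0
  /-- (vi) Serre relation `[E^m_{m+1}, E^{m-1}_{m+2}] = 0` -/
  serre6 : m ≠ 1 → n ≠ 1 →
    E m (m+1) * E (m-1) (m+2) -
      sgn m m (m+1) (m-1) (m+2) • (E (m-1) (m+2) * E m (m+1)) = 0
  /-- the nonsimple generators: for any `c` strictly between `a` and `b`,
  `E^a_b = E^a_c E^c_b - q_c^{sign(a-b)} E^c_b E^a_c` -/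
  nonsimple_def : ∀ a b c, 1 ≤ a → a ≤ m + n → 1 ≤ b → b ≤ m + n →
    ((a < c ∧ c < b) ∨ (b < c ∧ c < a)) →
    E a b = E a c * E c b - (if b < a then qi m c else (qi m c)⁻¹) • (E c b * E a c)

attribute [instance] UqGl.ringA UqGl.algA

namespace UqGl

variable {m n : ℕ}

/-- The graded commutator `[E^a_b, E^c_d] = E^a_b E^c_d - (-1)^{[E^a_b][E^c_d]} E^c_d E^a_b`. -/
def br (U : UqGl m n) (a b c d : ℕ) : U.A :=
  U.E a b * U.E c d - sgn m a b c d • (U.E c d * U.E a b)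

end UqGl

theorem qi_ne (m a : ℕ) : qi m a ≠ 0 := by
  have h : qq ≠ 0 := RatFunc.X_ne_zero
  unfold qi
  split_ifs
  · exact h
  · exact inv_ne_zero h

theorem Δq_ne : Δq ≠ 0 := by
  have h : qq ≠ 0 := RatFunc.X_ne_zero
  intro h0
  have h1 : qq * qq = 1 := by
    have : qq = qq⁻¹ := sub_eq_zero.mp h0
    calc qq * qq = qq * qq⁻¹ := by rw [← this]
      _ = 1 := mul_inv_cancel₀ h
  have h2 : (Polynomial.X * Polynomial.X : Polynomial ℚ) = 1 := by
    apply RatFunc.algebraMap_injective ℚ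
    simpa [qq, RatFunc.algebraMap_X] using h1
  have h3 := congrArg (Polynomial.eval 0) h2
  simp at h3

/-- sign attached to the simple root `k` -/
def ss (m k : ℕ) : Fq := if k = m then -1 else 1

theorem ss_sq (m k : ℕ) : ss m k * ss m k = 1 := by
  unfold ss; split_ifs <;> simp

theorem sgn_low (m a c b : ℕ) (h1 : c ≤ a) (h2 : a < b) : sgn m (a+1) a c b = ss m a := by
  unfold sgn ss gr
  split_ifs <;> first | omega | norm_num

theorem sgn_EF (m a : ℕ) : sgn m a (a+1) (a+1) a = ss m a := by
  unfold sgn ss gr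
  split_ifs <;> first | omega | norm_num

theorem sgn_EF_ne (m a b : ℕ) (h : a ≠ b) : sgn m a (a+1) (b+1) b = 1 := by
  unfold sgn gr
  split_ifs <;> first | omega | norm_num

theorem sgn_mul (m a c b : ℕ) :
    sgn m (a+1) c c b = sgn m (a+1) a c b * sgn m a c c b := by
  unfold sgn gr
  split_ifs <;> first | omega | norm_num

theorem ss_Δ (m c : ℕ) :
    ss m c * (Δi m c)⁻¹ * (qi m (c+1) - (qi m (c+1))⁻¹) = 1 := by
  have h := Δq_ne
  have h' : qq⁻¹ - qq = - Δq := by unfold Δq; ring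
  have h'' : qq - qq⁻¹ = Δq := rfl
  unfold ss Δi qi gr
  split_ifs <;> first | omega | (simp [h', h'', h])

section generic
variable {A : Type} [Ring A] {F : Type} [Field F] [Algebra F A]

theorem gen_qcomm {K Ki X : A} {w : F} (hw : w ≠ 0) (h1 : K * Ki = 1) (h2 : Ki * K = 1)
    (h : K * X = w • (X * K)) : Ki * X = w⁻¹ • (X * Ki) := by
  have : X * Ki = w • (Ki * X) := by
    calc X * Ki = Ki * (K * X) * Ki := by rw [← mul_assoc, h2, one_mul]
      _ = w • (Ki * X * (K * Ki)) := by
        rw [h]; simp only [mul_smul_comm, smul_mul_assoc, mul_assoc]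
      _ = _ := by rw [h1, mul_one]
  rw [this, smul_smul, inv_mul_cancel₀ hw, one_smul]

theorem gen_wt {K X Y : A} {u v t : F} (h1 : K * X = u • (X * K)) (h2 : K * Y = v • (Y * K)) :
    K * (X * Y - t • (Y * X)) = (u * v) • ((X * Y - t • (Y * X)) * K) := by
  have e1 : K * (X * Y) = (u * v) • (X * Y * K) := by
    rw [← mul_assoc, h1, smul_mul_assoc, mul_assoc, h2, mul_smul_comm, smul_smul, mul_assoc]
  have e2 : K * (Y * X) = (u * v) • (Y * X * K) := by
    rw [← mul_assoc, h2, smul_mul_assoc, mul_assoc, h1, mul_smul_comm, smul_smul, mul_assoc,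
      mul_comm v u]
  rw [mul_sub, mul_smul_comm, e1, e2, sub_mul, smul_mul_assoc]
  module

theorem gen_comm {f X Y : A} {t : F} (h1 : Commute f X) (h2 : Commute f Y) :
    Commute f (X * Y - t • (Y * X)) :=
  (h1.mul_right h2).sub_right ((h2.mul_right h1).smul_right t)

/-- First step: the bracket with a simple lowering generator. -/
theorem gen_step1 {e f Y H1 H2 : A} {s d q : F} (hs : s * s = 1)
    (hq : q ≠ 0) (hd : s * d * (q - q⁻¹) = 1)
    (hef : e * f - s • (f * e) = d • (H1 - H2))
    (hfY : f * Y = Y * f) (hH1 : H1 * Y = q⁻¹ • (Y * H1)) (hH2 : H2 * Y = q • (Y * H2)) :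
    f * (e * Y - q⁻¹ • (Y * e)) - s • ((e * Y - q⁻¹ • (Y * e)) * f) = Y * H2 := by
  have hfe : f * e = s • (e * f) - (s * d) • (H1 - H2) := by
    rw [mul_smul, ← hef, smul_sub, smul_smul, hs, one_smul]; abel
  have e1 : f * (e * Y) = s • (e * Y * f) - (s * d) • (q⁻¹ • (Y * H1) - q • (Y * H2)) := by
    rw [← mul_assoc, hfe, sub_mul, smul_mul_assoc, smul_mul_assoc, sub_mul, hH1, hH2,
      mul_assoc, hfY, mul_assoc]
  have e2 : f * (Y * e) = s • (Y * e * f) - (s * d) • (Y * H1 - Y * H2) := by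
    rw [← mul_assoc, hfY, mul_assoc, hfe, mul_sub, mul_smul_comm, mul_smul_comm, mul_sub,
      mul_assoc]
  have e3 : Y * H2 = (s * d * (q - q⁻¹)) • (Y * H2) := by rw [hd, one_smul]
  rw [e3, mul_sub, mul_smul_comm, e1, e2, sub_mul, smul_mul_assoc]
  module

/-- Second step: a simple lowering generator in the interior. -/
theorem gen_step2 {f X Y Z H : A} {s q : F} (hq : q ≠ 0)
    (hfX : f * X = X * f) (hfY : f * Y - s • (Y * f) = Z * H)
    (hXZ : X * Z = Z * X) (hH : H * X = q • (X * H)) :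
    f * (X * Y - q⁻¹ • (Y * X)) = s • ((X * Y - q⁻¹ • (Y * X)) * f) := by
  have h : f * Y = s • (Y * f) + Z * H := by rw [← hfY]; abel
  have e1 : f * (X * Y) = s • (X * Y * f) + X * Z * H := by
    rw [← mul_assoc, hfX, mul_assoc, h, mul_add, mul_smul_comm, mul_assoc, mul_assoc]
  have e2 : f * (Y * X) = s • (Y * X * f) + q • (X * Z * H) := by
    rw [← mul_assoc, h, add_mul, smul_mul_assoc, mul_assoc, hfX, mul_assoc Z, hH, mul_smul_comm,
      ← mul_assoc, ← mul_assoc, hXZ]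
  rw [mul_sub, mul_smul_comm, e1, e2, sub_mul, smul_mul_assoc, smul_add, smul_smul q⁻¹ q,
    inv_mul_cancel₀ hq, one_smul]
  module

/-- Third step: the induction on the lower index. -/
theorem gen_step3 {f g X W H H' Z : A} {s t q : F} (hq : q ≠ 0)
    (hfX : f * X = s • (X * f)) (hgX : g * X - t • (X * g) = W * H)
    (hHf : H * f = q⁻¹ • (f * H)) (hfW : f * W - s • (W * f) = Z * H') :
    (f * g - q • (g * f)) * X - (s * t) • (X * (f * g - q • (g * f))) = Z * H' * H := by
  have h : g * X = t • (X * g) + W * H := by rw [← hgX]; abel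
  have e1 : f * g * X = (s * t) • (X * (f * g)) + f * W * H := by
    rw [mul_assoc, h, mul_add, mul_smul_comm, ← mul_assoc f X, hfX, smul_mul_assoc, smul_smul,
      mul_comm t s, mul_assoc, mul_assoc]
  have e2 : g * f * X = (s * t) • (X * (g * f)) + (s * q⁻¹) • (W * f * H) := by
    rw [mul_assoc, hfX, mul_smul_comm, ← mul_assoc, h, add_mul, smul_mul_assoc, mul_assoc W, hHf,
      mul_smul_comm, smul_add, smul_smul, smul_smul, mul_assoc, mul_assoc]
  rw [← hfW, sub_mul, smul_mul_assoc, e1, e2, mul_sub, mul_smul_comm, sub_mul, smul_mul_assoc,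
    smul_add, smul_smul q (s * q⁻¹), show q * (s * q⁻¹) = s by field_simp]
  module

end generic

namespace UqGl

variable {m n : ℕ}

theorem raise_def (U : UqGl m n) {a b c : ℕ} (h1 : 1 ≤ a) (h2 : a < c) (h3 : c < b)
    (h4 : b ≤ m + n) :
    U.E a b = U.E a c * U.E c b - (qi m c)⁻¹ • (U.E c b * U.E a c) := by
  have := U.nonsimple_def a b c h1 (by omega) (by omega) h4 (Or.inl ⟨h2, h3⟩)
  rwa [if_neg (by omega)] at this

theorem lower_def (U : UqGl m n) {a b c : ℕ} (h1 : 1 ≤ b) (h2 : b < c) (h3 : c < a)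
    (h4 : a ≤ m + n) :
    U.E a b = U.E a c * U.E c b - qi m c • (U.E c b * U.E a c) := by
  have := U.nonsimple_def a b c (by omega) h4 h1 (by omega) (Or.inr ⟨h2, h3⟩)
  rwa [if_pos (by omega)] at this

theorem K_raise (U : UqGl m n) (x a b : ℕ) (hx : 1 ≤ x) (hx' : x ≤ m + n) (ha : 1 ≤ a)
    (hab : a + 1 ≤ b) (hb : b ≤ m + n) :
    U.K x * U.E a b = (qi m x ^ (δℤ x a - δℤ x b)) • (U.E a b * U.K x) := by
  induction b, hab using Nat.le_induction with
  | base => exact U.K_E_raise x a hx hx' ha hb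
  | succ b hab ih =>
    rw [U.raise_def ha (show a < b by omega) (Nat.lt_succ_self b) hb]
    rw [gen_wt (ih (by omega)) (U.K_E_raise x b hx hx' (by omega) hb), ← zpow_add₀ (qi_ne m x)]
    congr 2
    ring

theorem Kinv_raise (U : UqGl m n) (x a b : ℕ) (hx : 1 ≤ x) (hx' : x ≤ m + n) (ha : 1 ≤ a)
    (hab : a + 1 ≤ b) (hb : b ≤ m + n) :
    U.Kinv x * U.E a b = (qi m x ^ (δℤ x a - δℤ x b))⁻¹ • (U.E a b * U.Kinv x) :=
  gen_qcomm (zpow_ne_zero _ (qi_ne m x)) (U.K_Kinv x hx hx') (U.Kinv_K x hx hx')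
    (U.K_raise x a b hx hx' ha hab hb)

theorem K_Kinv_comm (U : UqGl m n) (a b : ℕ) (ha : 1 ≤ a) (ha' : a ≤ m + n) (hb : 1 ≤ b)
    (hb' : b ≤ m + n) : U.Kinv b * U.K a = U.K a * U.Kinv b := by
  have h := gen_qcomm (X := U.K a) (w := (1 : Fq)) one_ne_zero (U.K_Kinv b hb hb') (U.Kinv_K b hb hb')
    (by rw [one_smul, U.K_comm b a hb hb' ha ha'])
  simpa using h

theorem f_comm (U : UqGl m n) (k a b : ℕ) (hk : 1 ≤ k) (hk' : k + 1 ≤ m + n) (ha : 1 ≤ a)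
    (hab : a + 1 ≤ b) (hb : b ≤ m + n) (h : k < a ∨ b ≤ k) :
    Commute (U.E (k+1) k) (U.E a b) := by
  have simp_case : ∀ j, 1 ≤ j → j + 1 ≤ m + n → j ≠ k →
      Commute (U.E (k+1) k) (U.E j (j+1)) := by
    intro j h1 h2 h3
    have := U.EF_rel j k h1 h2 hk hk'
    rw [if_neg h3, zero_smul, sgn_EF_ne m j k h3, one_smul] at this
    exact (sub_eq_zero.mp this).symm
  induction b, hab using Nat.le_induction with
  | base => exact simp_case a ha hb (by omega)
  | succ b hab ih =>
    rw [U.raise_def ha (show a < b by omega) (Nat.lt_succ_self b) hb]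
    exact gen_comm (ih (by omega) (by omega)) (simp_case b (by omega) hb (by omega))

theorem e_comm (U : UqGl m n) (k a b : ℕ) (hk : 1 ≤ k) (hka : k + 1 < a)
    (hab : a + 1 ≤ b) (hb : b ≤ m + n) :
    Commute (U.E k (k+1)) (U.E a b) := by
  induction b, hab using Nat.le_induction with
  | base => exact U.EE_raise k a hk (by omega) (by omega) hb (Or.inl hka)
  | succ b hab ih =>
    rw [U.raise_def (by omega) (show a < b by omega) (Nat.lt_succ_self b) hb]
    exact gen_comm (ih (by omega))
      (U.EE_raise k b hk (by omega) (by omega) hb (Or.inl (by omega)))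

theorem ee_comm (U : UqGl m n) (c d a b : ℕ) (hc : 1 ≤ c) (hcd : c + 1 ≤ d) (hda : d < a)
    (hab : a + 1 ≤ b) (hb : b ≤ m + n) :
    Commute (U.E c d) (U.E a b) := by
  induction d, hcd using Nat.le_induction with
  | base => exact U.e_comm c a b hc hda hab hb
  | succ d hcd ih =>
    rw [U.raise_def hc (show c < d by omega) (Nat.lt_succ_self d) (by omega)]
    exact (gen_comm (ih (by omega)).symm
      (U.e_comm d a b (by omega) hda hab hb).symm).symm

theorem step1 (U : UqGl m n) (c b : ℕ) (hc : 1 ≤ c) (hcb : c + 1 < b) (hb : b ≤ m + n) :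
    U.E (c+1) c * U.E c b - ss m c • (U.E c b * U.E (c+1) c)
      = U.E (c+1) b * (U.K (c+1) * U.Kinv c) := by
  have hef := U.EF_rel c c hc (by omega) hc (by omega)
  rw [if_pos rfl, sgn_EF] at hef
  rw [U.raise_def hc (Nat.lt_succ_self c) hcb hb]
  have k1 := U.K_raise c (c+1) b hc (by omega) (by omega) hcb hb
  have k2 := U.K_raise (c+1) (c+1) b (by omega) (by omega) (by omega) hcb hb
  have k3 := U.Kinv_raise c (c+1) b hc (by omega) (by omega) hcb hb
  have k4 := U.Kinv_raise (c+1) (c+1) b (by omega) (by omega) (by omega) hcb hb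
  have d1 : δℤ c (c+1) - δℤ c b = 0 := by
    unfold δℤ; rw [if_neg (by omega), if_neg (by omega)]; rfl
  have d2 : δℤ (c+1) (c+1) - δℤ (c+1) b = 1 := by
    unfold δℤ; rw [if_pos rfl, if_neg (by omega)]; rfl
  rw [d1, zpow_zero] at k1 k3
  rw [d2, zpow_one] at k2 k4
  rw [inv_one, one_smul] at k3
  rw [one_smul] at k1
  rw [← U.K_Kinv_comm (c+1) c (by omega) (by omega) hc (by omega)]
  refine gen_step1 (ss_sq m c) (qi_ne m (c+1)) (ss_Δ m c) hef
    (U.f_comm c (c+1) b hc (by omega) (by omega) hcb hb (by omega)) ?_ ?_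
  · rw [mul_assoc, k4, mul_smul_comm, ← mul_assoc, k1, mul_assoc]
  · rw [mul_assoc, k2, mul_smul_comm, ← mul_assoc, k3, mul_assoc]

theorem step2 (U : UqGl m n) (c a b : ℕ) (hc : 1 ≤ c) (hca : c < a) (hab : a + 1 < b)
    (hb : b ≤ m + n) :
    U.E (a+1) a * U.E c b = ss m a • (U.E c b * U.E (a+1) a) := by
  rw [U.raise_def hc hca (show a < b by omega) hb]
  have k1 := U.K_raise (a+1) c a (by omega) (by omega) hc hca (by omega)
  have k2 := U.Kinv_raise a c a (by omega) (by omega) hc hca (by omega)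
  have d1 : δℤ (a+1) c - δℤ (a+1) a = 0 := by
    unfold δℤ; rw [if_neg (by omega), if_neg (by omega)]; rfl
  have d2 : δℤ a c - δℤ a a = -1 := by
    unfold δℤ; rw [if_pos rfl, if_neg (by omega)]; rfl
  rw [d1, zpow_zero, one_smul] at k1
  rw [d2, zpow_neg_one, inv_inv] at k2
  refine gen_step2 (qi_ne m a)
    (U.f_comm a c a (by omega) (by omega) hc hca (by omega) (by omega))
    (U.step1 a b (by omega) hab hb)
    (U.ee_comm c a (a+1) b hc hca (by omega) hab hb) ?_
  rw [mul_assoc, k2, mul_smul_comm, ← mul_assoc, k1, mul_assoc]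

theorem step3 (U : UqGl m n) (c a b : ℕ) (hc : 1 ≤ c) (hca : c + 1 ≤ a) (hab : a < b)
    (hb : b ≤ m + n) :
    U.E a c * U.E c b - sgn m a c c b • (U.E c b * U.E a c)
      = U.E a b * (U.K a * U.Kinv c) := by
  induction a, hca using Nat.le_induction with
  | base =>
    rw [sgn_low m c c b le_rfl (by omega)]
    exact U.step1 c b hc hab hb
  | succ a hca ih =>
    rw [U.lower_def hc (show c < a by omega) (Nat.lt_succ_self a) (by omega), sgn_mul,
      sgn_low m a c b (by omega) (by omega)]
    have k1 := U.K_E_lower a a (by omega) (by omega) (by omega) (by omega)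
    have k2 := U.K_E_lower c a hc (by omega) (by omega) (by omega)
    have d1 : δℤ a (a+1) - δℤ a a = -1 := by
      unfold δℤ; rw [if_pos rfl, if_neg (by omega)]; rfl
    have d2 : δℤ c (a+1) - δℤ c a = 0 := by
      unfold δℤ; rw [if_neg (by omega), if_neg (by omega)]; rfl
    rw [d1, zpow_neg_one] at k1
    rw [d2, zpow_zero] at k2
    have k3 := gen_qcomm one_ne_zero (U.K_Kinv c hc (by omega)) (U.Kinv_K c hc (by omega)) k2
    rw [inv_one, one_smul] at k3
    have h := gen_step3 (H := U.K a * U.Kinv c) (qi_ne m a)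
      (U.step2 c a b hc (by omega) hab hb) (ih (by omega))
      (by rw [mul_assoc, k3, ← mul_assoc, k1, smul_mul_assoc, mul_assoc])
      (U.step1 a b (by omega) hab hb)
    rw [h, mul_assoc, mul_assoc (U.K (a+1)), ← mul_assoc (U.Kinv a),
      U.Kinv_K a (by omega) (by omega), one_mul]

end UqGl

theorem stmt2 (m n : ℕ) (hm : 1 ≤ m) (hn : 1 ≤ n) (U : UqGl m n)
    (a b c : ℕ)
    (h1 : 1 ≤ a) (h2 : a ≤ m + n) (h3 : 1 ≤ b) (h4 : b ≤ m + n)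
    (h5 : 1 ≤ c) (h6 : c ≤ m + n)
    (hca : c < a) (hab : a < b) :
    U.br a c c b = U.E a b * U.K a * U.Kinv c := by
  unfold UqGl.br
  rw [U.step3 c a b h5 hca hab h4, mul_assoc]

end
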